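/- (i) Let (ω,κ) be a marked composition and d an integer with |(ω,κ)| ≤ d and d − |(ω,κ)| even. Then the set {x : x ⪯ (ω,κ) and |x| = d} is nonempty and the minimum of |x|' over this set equals |(ω,κ)|' + (d − |(ω,κ)|)/2. (ii) If Θ ⊆ Ω^∞_{⟨d]} is a nonempty closed set of marked compositions, then {x ∈ Θ : |x| = d} is nonempty and the minimum of |x|' over this set equals d − ψ_Θ(d) = (d − η_Θ(d))/2. (Topologically, d minus these minima are the dimensions of the subspaces K_d^{(ω,κ)} and K_d^Θ of classes of binary forms with all roots real.) -/

import Mathlib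

/-- A composition: a (possibly empty) list of positive integers. -/
abbrev Comp : Type := List PNat

/-- A marked composition: a composition together with a mark `κ : ℕ`. -/
abbrev MComp : Type := List PNat × ℕ

/-- The norm `|ω|` of a composition. -/
def normC (ω : Comp) : ℕ := (ω.map fun a => (a : ℕ)).sum

/-- The reduced norm `|ω|' = |ω| - ℓ` of a composition. -/
def rnormC (ω : Comp) : ℕ := normC ω - ω.length

/-- The norm of a marked composition. -/
def normM (x : MComp) : ℕ := normC x.1 + x.2

/-- The reduced norm of a marked composition. -/
def rnormM (x : MComp) : ℕ := rnormC x.1 + x.2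

/-- Merge the parts at (0-indexed) positions `k` and `k+1` of a composition. -/
def mergeAux : Comp → ℕ → Comp
  | a :: b :: t, 0 => (a + b) :: t
  | a :: t, n + 1 => a :: mergeAux t n
  | l, _ => l

/-- The merge operation `M_k^∞` (`0 ≤ k ≤ ℓ`) on marked compositions:
`M_0^∞` moves the first part to the mark, `M_ℓ^∞` moves the last part to the mark, and
for `1 ≤ k ≤ ℓ-1`, `M_k^∞` merges the `k`-th and `(k+1)`-st parts (1-indexed). -/
def mergeM (x : MComp) (k : ℕ) : MComp :=
  if k = 0 then
    match x.1 with
    | [] => x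
    | a :: t => (t, x.2 + (a : ℕ))
  else if k = x.1.length then
    match x.1.getLast? with
    | none => x
    | some a => (x.1.dropLast, x.2 + (a : ℕ))
  else (mergeAux x.1 (k - 1), x.2)

/-- The insert operation `I_k` (`0 ≤ k ≤ ℓ`): insert a part `2` after the first `k` parts. -/
def insertC (ω : Comp) (k : ℕ) : Comp := ω.take k ++ (2 : PNat) :: ω.drop k

/-- The insert operation `I_k^∞` on marked compositions. -/
def insertM (x : MComp) (k : ℕ) : MComp := (insertC x.1 k, x.2)

/-- One merge or insert step on marked compositions: `mstep y x` means `x` is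
obtained from `y` by a single operation. -/
def mstep (y x : MComp) : Prop :=
  (∃ k ≤ y.1.length, y.1 ≠ [] ∧ x = mergeM y k) ∨ ∃ k ≤ y.1.length, x = insertM y k

/-- `mprec x y` is the relation `x ⪯ y` on marked compositions. -/
def mprec (x y : MComp) : Prop := Relation.ReflTransGen mstep y x

/-- One merge or insert step on compositions: merges `M_j`, `1 ≤ j ≤ ℓ-1`
(0-indexed: positions `k, k+1` with `k + 2 ≤ ℓ`), and all inserts. -/
def cstep (y x : Comp) : Prop :=
  (∃ k, k + 2 ≤ y.length ∧ x = mergeAux y k) ∨ ∃ k ≤ y.length, x = insertC y k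

/-- `cprec x y` is the relation `x ⪯ y` on compositions. -/
def cprec (x y : Comp) : Prop := Relation.ReflTransGen cstep y x

theorem aux_normC_cons (a : PNat) (t : Comp) : normC (a :: t) = (a : ℕ) + normC t := by
  simp [normC]

theorem aux_normC_append (s t : Comp) : normC (s ++ t) = normC s + normC t := by
  simp [normC]

theorem aux_length_le (l : Comp) : l.length ≤ normC l := by
  induction l with
  | nil => simp
  | cons a t ih =>
    have := a.pos
    rw [aux_normC_cons, List.length_cons]
    omega

theorem aux_mergeAux (l : Comp) (k : ℕ) :
    normC (mergeAux l k) = normC l ∧ (mergeAux l k).length ≤ l.length := by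
  induction l generalizing k with
  | nil => simp [mergeAux]
  | cons a t ih =>
    cases k with
    | zero =>
      cases t with
      | nil => simp [mergeAux]
      | cons b t =>
        simp only [mergeAux, aux_normC_cons, PNat.add_coe, List.length_cons]
        omega
    | succ n =>
      obtain ⟨h1, h2⟩ := ih n
      simp only [mergeAux, aux_normC_cons, List.length_cons]
      omega

theorem aux_rnormM (x : MComp) : rnormM x + x.1.length = normM x := by
  have := aux_length_le x.1
  unfold rnormM normM rnormC
  omega

theorem aux_mergeM (x : MComp) (k : ℕ) :
    normM (mergeM x k) = normM x ∧ (mergeM x k).1.length ≤ x.1.length := by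
  obtain ⟨l, m⟩ := x
  unfold mergeM
  split_ifs with h1 h2
  · cases l with
    | nil => simp
    | cons a t =>
      simp only [normM, aux_normC_cons, List.length_cons]
      omega
  · rcases List.eq_nil_or_concat l with rfl | ⟨t, a, rfl⟩
    · simp
    · simp [normM, aux_normC_append, normC]
      omega
  · have := aux_mergeAux l (k - 1)
    simp only [normM]
    omega

theorem aux_insertM (x : MComp) (k : ℕ) :
    normM (insertM x k) = normM x + 2 ∧ (insertM x k).1.length = x.1.length + 1 := by
  obtain ⟨l, m⟩ := x
  have h : normC l = normC (l.take k) + normC (l.drop k) := by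
    rw [← aux_normC_append, List.take_append_drop]
  have h' : l.length = (l.take k).length + (l.drop k).length := by
    rw [← List.length_append, List.take_append_drop]
  have h2 : ((2 : PNat) : ℕ) = 2 := rfl
  simp only [normM, insertM, insertC, aux_normC_append, aux_normC_cons, List.length_append,
    List.length_cons]
  omega

theorem aux_mprec {x y : MComp} (h : mprec x y) :
    normM x + 2 * rnormM y ≤ normM y + 2 * rnormM x := by
  unfold mprec at h
  induction h with
  | refl => exact le_rfl
  | @tail b c _ hs ih =>
    have hb := aux_rnormM b
    have hc := aux_rnormM c
    rcases hs with ⟨k, _, _, rfl⟩ | ⟨k, _, rfl⟩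
    · have := aux_mergeM b k
      omega
    · have := aux_insertM b k
      omega

theorem aux_exists (y : MComp) (n : ℕ) :
    ∃ x, mprec x y ∧ normM x = normM y + 2 * n ∧ rnormM x = rnormM y + n := by
  induction n with
  | zero => exact ⟨y, Relation.ReflTransGen.refl, rfl, rfl⟩
  | succ n ih =>
    obtain ⟨x, h1, h2, h3⟩ := ih
    have h4 := aux_insertM x 0
    have h5 := aux_rnormM x
    have h6 := aux_rnormM (insertM x 0)
    exact ⟨insertM x 0, Relation.ReflTransGen.tail h1 (Or.inr ⟨0, Nat.zero_le _, rfl⟩),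
      by omega, by omega⟩

/-- (i) For a marked composition `y` and `d` with `|y| ≤ d`, `d - |y|`
even, the minimum of `|x|'` over `{x ⪯ y, |x| = d}` is attained and equals
`|y|' + (d - |y|)/2`. (ii) For a nonempty closed `Θ ⊆ Ω^∞_{⟨d]}` with
`η = η_Θ(d) = max {|x| - 2|x|' : x ∈ Θ}`, the minimum of `|x|'` over
`{x ∈ Θ : |x| = d}` is attained and equals `d - ψ_Θ(d) = (d - η)/2`. -/
theorem min_reduced_norm_at_top (d : ℕ) :
    (∀ y : MComp, normM y ≤ d → Even (d - normM y) →
      IsLeast {n : ℕ | ∃ x : MComp, mprec x y ∧ normM x = d ∧ n = rnormM x}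
        (rnormM y + (d - normM y) / 2)) ∧
    (∀ Θ : Set MComp, Θ.Nonempty →
      Θ ⊆ {x : MComp | normM x ≤ d ∧ normM x % 2 = d % 2} →
      (∀ y ∈ Θ, ∀ x : MComp, mprec x y → normM x ≤ d → x ∈ Θ) →
      ∀ η : ℤ,
        IsGreatest {v : ℤ | ∃ x ∈ Θ, v = (normM x : ℤ) - 2 * (rnormM x : ℤ)} η →
        IsLeast {n : ℤ | ∃ x ∈ Θ, normM x = d ∧ n = (rnormM x : ℤ)}
          (((d : ℤ) - η) / 2)) := by
  constructor
  · intro y hy he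
    obtain ⟨n, hn⟩ := he
    constructor
    · obtain ⟨x, h1, h2, h3⟩ := aux_exists y n
      exact ⟨x, h1, by omega, by omega⟩
    · rintro m ⟨x, h1, h2, rfl⟩
      have := aux_mprec h1
      omega
  · intro Θ _ hsub hcl η hη
    obtain ⟨⟨y, hy, hv⟩, hub⟩ := hη
    constructor
    · obtain ⟨ha, hb⟩ := hsub hy
      obtain ⟨x, h1, h2, h3⟩ := aux_exists y ((d - normM y) / 2)
      exact ⟨x, hcl y hy x h1 (by omega), by omega, by omega⟩
    · rintro m ⟨x, h1, h2, rfl⟩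
      have := hub ⟨x, h1, rfl⟩
      omega
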